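/- arXiv:1907.06585 — 4 statements merged into one kernel-verified Lean document; each statement's English description precedes it below -/
import Mathlib

section
/- Let C be a category and M a class of monomorphisms of C that is stable under pushout and such that pushouts along M-morphisms exist. For every M-weak span ρ = (L ←l− K ←i− I −r→ R), fix a pushout (i', r', R') of (I, i, r), giving the associated span â(ρ) = (L ←l− K −r'→ R'). Then for all objects G and H of C: there exists a Weak Double-Pushout diagram γ of G by ρ with result H (i.e. G ⟹γ H) if and only if there exists a Double-Pushout diagram δ of G by â(ρ) with result H (i.e. G ⟹δ H). -/
open CategoryTheory

universe v u

/-- A weak span `L ←l− K ←i− I −r→ R` in a category `C`. -/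
structure WeakSpan (C : Type u) [Category.{v} C] where
  L : C
  K : C
  I : C
  R : C
  l : K ⟶ L
  i : I ⟶ K
  r : I ⟶ R

/-- A direct transformation of `G` by the weak span `ρ`, with result `H`:
morphisms `m, k, f, g, n` such that `f ∘ k = m ∘ l` and `(g, n, H)` is a
pushout of `(I, r, k ∘ i)`. -/
structure DirectTransformation {C : Type u} [Category.{v} C] (ρ : WeakSpan C) (G H : C) where
  D : C
  m : ρ.L ⟶ G
  k : ρ.K ⟶ D
  f : D ⟶ G
  g : D ⟶ H
  n : ρ.R ⟶ H
  comm : k ≫ f = ρ.l ≫ m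
  po : IsPushout (ρ.i ≫ k) ρ.r g n

/-- A direct transformation is a Weak Double-Pushout when `(f, m, G)` is a
pushout of `(K, l, k)`. -/
def DirectTransformation.IsWDPO {C : Type u} [Category.{v} C] {ρ : WeakSpan C} {G H : C}
    (γ : DirectTransformation ρ G H) : Prop :=
  IsPushout ρ.l γ.k γ.m γ.f

/-- A span rule `L ←l− K −r→ R`. -/
structure SpanRule (C : Type u) [Category.{v} C] where
  L : C
  K : C
  R : C
  l : K ⟶ L
  r : K ⟶ R

/-- A Double-Pushout diagram of `G` by the span `σ` with result `H`. -/
structure DPOTransformation {C : Type u} [Category.{v} C] (σ : SpanRule C) (G H : C) where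
  D : C
  m : σ.L ⟶ G
  k : σ.K ⟶ D
  f : D ⟶ G
  g : D ⟶ H
  n : σ.R ⟶ H
  po₁ : IsPushout σ.l k m f
  po₂ : IsPushout σ.r k n g

/-- Let `M` be a class of monomorphisms stable under pushout such
that pushouts along `M`-morphisms exist.  For an `M`-weak span `ρ` with a fixed
pushout `(i', r', R')` of `(I, i, r)` (giving the associated span `â(ρ) = (l, r')`),
a Weak Double-Pushout of `G` by `ρ` with result `H` exists iff a Double-Pushout of
`G` by `â(ρ)` with result `H` exists. -/
theorem associated_span_correspondence {C : Type u} [Category.{v} C]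
    (M : MorphismProperty C)
    (hMono : ∀ ⦃X Y : C⦄ (f : X ⟶ Y), M f → Mono f)
    (hStable : ∀ ⦃X Y Z W : C⦄ (f : X ⟶ Y) (g : X ⟶ Z) (h : Y ⟶ W) (i : Z ⟶ W),
        IsPushout f g h i → M f → M i)
    (hExists : ∀ ⦃X Y Z : C⦄ (f : X ⟶ Y) (g : X ⟶ Z), M f →
        ∃ (W : C) (h : Y ⟶ W) (i : Z ⟶ W), IsPushout f g h i)
    (ρ : WeakSpan C) (hl : M ρ.l) (hi : M ρ.i) (hr : M ρ.r)
    (R' : C) (r' : ρ.K ⟶ R') (i' : ρ.R ⟶ R') (hpo : IsPushout ρ.i ρ.r r' i')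
    (G H : C) :
    (∃ γ : DirectTransformation ρ G H, γ.IsWDPO) ↔
      Nonempty (DPOTransformation (SpanRule.mk ρ.L ρ.K R' ρ.l r') G H) := by
  constructor
  · rintro ⟨γ, hγ⟩
    have hn : ρ.r ≫ γ.n = ρ.i ≫ γ.k ≫ γ.g := by rw [← γ.po.w, Category.assoc]
    have hpaste : IsPushout (ρ.i ≫ γ.k) ρ.r γ.g (i' ≫ hpo.desc (γ.k ≫ γ.g) γ.n hn.symm) := by
      rw [hpo.inr_desc]
      exact γ.po
    exact ⟨γ.D, γ.m, γ.k, γ.f, γ.g, hpo.desc (γ.k ≫ γ.g) γ.n hn.symm, hγ,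
      (hpaste.of_left (hpo.inl_desc _ _ _).symm hpo).flip⟩
  · rintro ⟨δ⟩
    exact ⟨⟨δ.D, δ.m, δ.k, δ.f, δ.g, i' ≫ δ.n, δ.po₁.w.symm, hpo.paste_horiz δ.po₂.flip⟩, δ.po₁⟩
end

section
/- Let C be a category and M a class of monomorphisms such that M is stable under pushout, and suppose f₁ : D₁ → G and f₂ : D₂ → G are monomorphisms lying in pushout squares along M-morphisms (so f₁, f₂ ∈ M). If Weak Double-Pushouts γ₁ and γ₂ of G by weak spans ρ₁ and ρ₂ are parallel independent with witnesses j₁ : L₁ → D₂, j₂ : L₂ → D₁ (f₂∘j₁ = m₁, f₁∘j₂ = m₂), and are also parallel coherent with witnesses j₁² : I₁ → D₂, j₂¹ : I₂ → D₁ (f₂∘j₁² = f₁∘k₁∘i₁, f₁∘j₂¹ = f₂∘k₂∘i₂), then necessarily j₁² = j₁∘l₁∘i₁ and j₂¹ = j₂∘l₂∘i₂. -/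
open CategoryTheory

universe v u

/-- If `M` is a class of monomorphisms stable under pushout and
`l₁, l₂ ∈ M` (so that `f₁, f₂`, being pushouts of `l₁, l₂` in the Weak
Double-Pushouts, lie in `M` and are monomorphisms), then parallel-coherence
witnesses are forced: `j₁² = j₁ ∘ l₁ ∘ i₁` and `j₂¹ = j₂ ∘ l₂ ∘ i₂`. -/
theorem coherence_witnesses_unique
    {C : Type u} [Category.{v} C] (M : MorphismProperty C)
    (hMono : ∀ ⦃X Y : C⦄ (f : X ⟶ Y), M f → Mono f)
    (hStable : ∀ ⦃X Y Z W : C⦄ (f : X ⟶ Y) (g : X ⟶ Z) (h : Y ⟶ W) (i : Z ⟶ W),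
        IsPushout f g h i → M f → M i)
    {ρ₁ ρ₂ : WeakSpan C} (hl₁ : M ρ₁.l) (hl₂ : M ρ₂.l)
    {G H₁ H₂ : C}
    (γ₁ : DirectTransformation ρ₁ G H₁) (γ₂ : DirectTransformation ρ₂ G H₂)
    (w₁ : γ₁.IsWDPO) (w₂ : γ₂.IsWDPO)
    (j₁ : ρ₁.L ⟶ γ₂.D) (j₂ : ρ₂.L ⟶ γ₁.D)
    (hj₁ : j₁ ≫ γ₂.f = γ₁.m) (hj₂ : j₂ ≫ γ₁.f = γ₂.m)
    (j12 : ρ₁.I ⟶ γ₂.D) (j21 : ρ₂.I ⟶ γ₁.D)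
    (hc₁ : j12 ≫ γ₂.f = ρ₁.i ≫ γ₁.k ≫ γ₁.f)
    (hc₂ : j21 ≫ γ₁.f = ρ₂.i ≫ γ₂.k ≫ γ₂.f) :
    j12 = ρ₁.i ≫ ρ₁.l ≫ j₁ ∧ j21 = ρ₂.i ≫ ρ₂.l ≫ j₂ := by
  have hf₁ : Mono γ₁.f := hMono _ (hStable _ _ _ _ w₁ hl₁)
  have hf₂ : Mono γ₂.f := hMono _ (hStable _ _ _ _ w₂ hl₂)
  constructor
  · rw [← cancel_mono γ₂.f, hc₁, γ₁.comm]
    simp only [Category.assoc, hj₁]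
  · rw [← cancel_mono γ₁.f, hc₂, γ₂.comm]
    simp only [Category.assoc, hj₂]
end

section
/- Let C be any category, p ≥ 1, let (C, s₁,…,s_p) be a source with s_a : C → F_a, and let (h₁,…,h_p, H) be a colimit of this source (a wide pushout). Suppose given morphisms h : H → H', c : C → C', and for each a morphisms t'_a : F_a → F'_a, s'_a : C' → F'_a, h'_a : F'_a → H' such that for each a the square with sides s_a : C → F_a, c : C → C', t'_a : F_a → F'_a, s'_a : C' → F'_a is a pushout, and the square with sides h_a : F_a → H, t'_a : F_a → F'_a, h : H → H', h'_a : F'_a → H' is a pushout. If moreover h'_a∘s'_a = h'_b∘s'_b for all 1 ≤ a, b ≤ p, then (h'₁,…,h'_p, H') is a colimit of the source (C', s'₁,…,s'_p). -/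
open CategoryTheory

universe v u

/-- `(P, e)` is a limit (wide pullback) of the sink `(f, G)`: a natural source
through which every natural source factors uniquely. -/
def IsWideLimitSink {C : Type u} [Category.{v} C] {ι : Type} {D : ι → C} {G : C}
    (f : ∀ a, D a ⟶ G) (P : C) (e : ∀ a, P ⟶ D a) : Prop :=
  (∀ a b, e a ≫ f a = e b ≫ f b) ∧
    ∀ (X : C) (u : ∀ a, X ⟶ D a), (∀ a b, u a ≫ f a = u b ≫ f b) →
      ∃! x : X ⟶ P, ∀ a, x ≫ e a = u a

/-- `(h, H)` is a colimit (wide pushout) of the source `(P, s)`: a natural sink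
through which every natural sink factors uniquely. -/
def IsWideColimitSource {C : Type u} [Category.{v} C] {ι : Type} {F : ι → C} {P : C}
    (s : ∀ a, P ⟶ F a) {H : C} (h : ∀ a, F a ⟶ H) : Prop :=
  (∀ a b, s a ≫ h a = s b ≫ h b) ∧
    ∀ (X : C) (u : ∀ a, F a ⟶ X), (∀ a b, s a ≫ u a = s b ≫ u b) →
      ∃! x : H ⟶ X, ∀ a, h a ≫ x = u a

/-- In any category, let `(h₁,…,h_p, H)` be a colimit (wide
pushout) of a source `(Cobj, s₁,…,s_p)`, `p ≥ 1`.  If for each `a` the squares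
`(s_a, c, t'_a, s'_a)` and `(h_a, t'_a, h, h'_a)` are pushouts, and
`h'_a ∘ s'_a = h'_b ∘ s'_b` for all `a, b`, then `(h'₁,…,h'_p, H')` is a
colimit of the source `(C', s'₁,…,s'_p)`. -/
theorem shift_wide_colimit {C : Type u} [Category.{v} C]
    {p : ℕ} (hp : 1 ≤ p) {F : Fin p → C} {Cobj : C}
    (s : ∀ a, Cobj ⟶ F a) {H : C} (h : ∀ a, F a ⟶ H)
    (hcolim : IsWideColimitSource s h)
    {H' : C} (hH : H ⟶ H') {C' : C} (c : Cobj ⟶ C')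
    {F' : Fin p → C} (t' : ∀ a, F a ⟶ F' a)
    (s' : ∀ a, C' ⟶ F' a) (h' : ∀ a, F' a ⟶ H')
    (hpo₁ : ∀ a, IsPushout (s a) c (t' a) (s' a))
    (hpo₂ : ∀ a, IsPushout (h a) (t' a) hH (h' a))
    (hcomm : ∀ a b, s' a ≫ h' a = s' b ≫ h' b) :
    IsWideColimitSource s' h' := by
  refine ⟨hcomm, fun X u hu => ?_⟩
  let a₀ : Fin p := ⟨0, hp⟩
  obtain ⟨x, hx, hx_unique⟩ := hcolim.2 X (fun a => t' a ≫ u a) fun a b => by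
    rw [(hpo₁ a).w_assoc, (hpo₁ b).w_assoc, hu a b]
  obtain ⟨y, hy, hy₀⟩ := (hpo₂ a₀).exists_desc x (u a₀) (hx a₀)
  refine ⟨y, fun a => (hpo₁ a).hom_ext ?_ ?_, fun z hz => (hpo₂ a₀).hom_ext ?_ ?_⟩
  · rw [← (hpo₂ a).w_assoc, hy]
    exact hx a
  · rw [reassoc_of% hcomm a a₀, hy₀, hu a₀ a]
  · rw [hy]
    refine hx_unique _ fun a => ?_
    rw [(hpo₂ a).w_assoc, hz a]
  · rw [hz a₀, hy₀]
end

section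
/- Let C be a category and M a class of monomorphisms of C that is stable under pushout and such that pushouts along M-morphisms exist. For every M-weak span ρ and all objects G, H such that G ⟹ρ H (i.e. there is a Weak Double-Pushout of G by ρ with result H), the associated span â(ρ) is a derived rule of G ⟹ρ H: that is, G ⟹â(ρ) H by a Double-Pushout, and for all objects G', H', if G' ⟹â(ρ) H' by a Double-Pushout then G' ⟹ρ H' by a Weak Double-Pushout. -/
open CategoryTheory

universe v u

/-- Let `M` be a class of monomorphisms stable under pushout
such that pushouts along `M`-morphisms exist, and let `ρ` be an `M`-weak span
with associated span `â(ρ) = (l, r')` given by a pushout `(i', r', R')` of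
`(I, i, r)`.  If `G ⟹ρ H` by a Weak Double-Pushout, then `â(ρ)` is a derived
rule of `G ⟹ρ H`: `G ⟹â(ρ) H` by a Double-Pushout, and every Double-Pushout
`G' ⟹â(ρ) H'` yields a Weak Double-Pushout `G' ⟹ρ H'`. -/
theorem associated_span_is_derived_rule {C : Type u} [Category.{v} C]
    (M : MorphismProperty C)
    (hMono : ∀ ⦃X Y : C⦄ (f : X ⟶ Y), M f → Mono f)
    (hStable : ∀ ⦃X Y Z W : C⦄ (f : X ⟶ Y) (g : X ⟶ Z) (h : Y ⟶ W) (i : Z ⟶ W),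
        IsPushout f g h i → M f → M i)
    (hExists : ∀ ⦃X Y Z : C⦄ (f : X ⟶ Y) (g : X ⟶ Z), M f →
        ∃ (W : C) (h : Y ⟶ W) (i : Z ⟶ W), IsPushout f g h i)
    (ρ : WeakSpan C) (hl : M ρ.l) (hi : M ρ.i) (hr : M ρ.r)
    (R' : C) (r' : ρ.K ⟶ R') (i' : ρ.R ⟶ R') (hpo : IsPushout ρ.i ρ.r r' i')
    (G H : C) (hGH : ∃ γ : DirectTransformation ρ G H, γ.IsWDPO) :
    Nonempty (DPOTransformation (SpanRule.mk ρ.L ρ.K R' ρ.l r') G H) ∧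
      ∀ G' H' : C,
        Nonempty (DPOTransformation (SpanRule.mk ρ.L ρ.K R' ρ.l r') G' H') →
        ∃ γ' : DirectTransformation ρ G' H', γ'.IsWDPO := by
  refine ⟨?_, ?_⟩
  · obtain ⟨γ, hγ⟩ := hGH
    have comm : ρ.i ≫ γ.k ≫ γ.g = ρ.r ≫ γ.n := by simpa using γ.po.w
    have right : IsPushout γ.k r' γ.g (hpo.desc (γ.k ≫ γ.g) γ.n comm) :=
      IsPushout.of_left (by simpa using γ.po) (hpo.inl_desc _ _ comm).symm hpo
    exact ⟨⟨γ.D, γ.m, γ.k, γ.f, γ.g, _, hγ, right.flip⟩⟩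
  · rintro G' H' ⟨δ⟩
    exact ⟨⟨δ.D, δ.m, δ.k, δ.f, δ.g, i' ≫ δ.n, δ.po₁.w.symm, hpo.paste_horiz δ.po₂.flip⟩, δ.po₁⟩
end
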